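/- arXiv:2107.04060 — 3 statements merged into one kernel-verified Lean document; each statement's English description precedes it below -/
import Mathlib

section
/- (Theorem 2.2, coercivity via a constructed test function.) In the abstract discrete Biot setting, assume hypotheses (H1) and (H2). Then there exists a constant γ* > 0 depending only on γ_B such that for every x = (u, w, p) ∈ V × W × Q there exists y = (v, r, q) ∈ V × W × Q with B(x, y) ≥ γ̄ · ‖x‖_D², where γ̄ := min{1/6, 3γ_B²/8}, and ‖y‖_D ≤ γ* · ‖x‖_D. -/
open RealInnerProductSpace

/-- The abstract discrete Biot bilinear form. -/
noncomputable def biotForm {V W Q : Type*}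
    [NormedAddCommGroup V] [InnerProductSpace ℝ V]
    [NormedAddCommGroup W] [InnerProductSpace ℝ W]
    [NormedAddCommGroup Q] [InnerProductSpace ℝ Q]
    (Bu : V →ₗ[ℝ] Q) (Bw : W →ₗ[ℝ] Q) (α τ M : ℝ)
    (x y : V × W × Q) : ℝ :=
  ⟪x.1, y.1⟫ - α * ⟪x.2.2, Bu y.1⟫ + τ * ⟪x.2.1, y.2.1⟫ - τ * ⟪x.2.2, Bw y.2.1⟫
    - τ * ⟪Bw x.2.1, y.2.2⟫ - (1 / M) * ⟪x.2.2, y.2.2⟫ - α * ⟪Bu x.1, y.2.2⟫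

/-- The squared weighted norm `‖(u,w,p)‖_D²`. -/
noncomputable def biotNormSq {V W Q : Type*}
    [NormedAddCommGroup V] [InnerProductSpace ℝ V]
    [NormedAddCommGroup W] [InnerProductSpace ℝ W]
    [NormedAddCommGroup Q] [InnerProductSpace ℝ Q]
    (Bw : W →ₗ[ℝ] Q) (τ cp : ℝ) (x : V × W × Q) : ℝ :=
  ‖x.1‖ ^ 2 + cp⁻¹ * ‖x.2.2‖ ^ 2 + τ * ‖x.2.1‖ ^ 2 + τ ^ 2 * cp * ‖Bw x.2.1‖ ^ 2

section BiotAux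

variable {V W Q : Type*}
  [NormedAddCommGroup V] [InnerProductSpace ℝ V]
  [NormedAddCommGroup W] [InnerProductSpace ℝ W]
  [NormedAddCommGroup Q] [InnerProductSpace ℝ Q]

theorem biotForm_smul_right (Bu : V →ₗ[ℝ] Q) (Bw : W →ₗ[ℝ] Q) (α τ M c : ℝ)
    (x y : V × W × Q) :
    biotForm Bu Bw α τ M x (c • y) = c * biotForm Bu Bw α τ M x y := by
  simp only [biotForm, Prod.smul_fst, Prod.smul_snd, map_smul, inner_smul_right]
  ring

theorem biotNormSq_smul (Bw : W →ₗ[ℝ] Q) (τ cp c : ℝ) (x : V × W × Q) :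
    biotNormSq Bw τ cp (c • x) = c ^ 2 * biotNormSq Bw τ cp x := by
  simp only [biotNormSq, Prod.smul_fst, Prod.smul_snd, map_smul, norm_smul, mul_pow,
    Real.norm_eq_abs, sq_abs]
  ring

theorem norm_sub_sq_le_two_mul (a b : V) : ‖a - b‖ ^ 2 ≤ 2 * ‖a‖ ^ 2 + 2 * ‖b‖ ^ 2 := by
  nlinarith [parallelogram_law_with_norm ℝ a b, sq_nonneg ‖a + b‖]

/-- The unscaled test function attached to `(u, w, p)` and an inf-sup partner `z` of `p`. -/
noncomputable def biotTest (Bw : W →ₗ[ℝ] Q) (τ cp s : ℝ) (x : V × W × Q) (z : V) : V × W × Q :=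
  (x.1 - s • z, x.2.1, -x.2.2 - (τ * cp / 2) • Bw x.2.1)

theorem biotForm_biotTest (Bu : V →ₗ[ℝ] Q) (Bw : W →ₗ[ℝ] Q) (α τ M cp s : ℝ)
    (x : V × W × Q) (z : V) :
    biotForm Bu Bw α τ M x (biotTest Bw τ cp s x z) =
      ‖x.1‖ ^ 2 - s * ⟪x.1, z⟫ + s * α * ⟪x.2.2, Bu z⟫ + τ * ‖x.2.1‖ ^ 2
        + τ ^ 2 * cp / 2 * ‖Bw x.2.1‖ ^ 2 + 1 / M * ‖x.2.2‖ ^ 2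
        + 1 / M * (τ * cp / 2) * ⟪x.2.2, Bw x.2.1⟫
        + τ * cp / 2 * (α * ⟪Bu x.1, Bw x.2.1⟫) := by
  simp only [biotForm, biotTest, map_sub, map_smul, inner_sub_right, inner_neg_right,
    inner_smul_right, real_inner_self_eq_norm_sq]
  rw [real_inner_comm x.2.2 (Bu x.1), real_inner_comm x.2.2 (Bw x.2.1)]
  ring

theorem biotForm_biotTest_ge {Bu : V →ₗ[ℝ] Q} {Bw : W →ₗ[ℝ] Q} {α τ M ζ cp γ : ℝ}
    (hα : 0 < α) (hτ : 0 < τ) (hM : 0 < M) (hζ : 0 < ζ) (hγ : 0 < γ)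
    (hcp : cp = (α ^ 2 / ζ ^ 2 + 1 / M)⁻¹)
    (hBu : ∀ u : V, ζ * ‖Bu u‖ ≤ ‖u‖) (x : V × W × Q) {z : V}
    (hz : ‖z‖ = ‖x.2.2‖) (hpz : γ / ζ * ‖x.2.2‖ ^ 2 ≤ ⟪x.2.2, Bu z⟫) :
    min (1 / 8) (9 * γ ^ 2 / 32) * biotNormSq Bw τ cp x ≤
      biotForm Bu Bw α τ M x (biotTest Bw τ cp (γ * (α / ζ)) x z) := by
  obtain ⟨u, w, p⟩ := x
  rw [biotForm_biotTest]
  simp only [biotNormSq] at *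
  have hcinv : cp⁻¹ = (α / ζ) ^ 2 + 1 / M := by rw [hcp, inv_inv, div_pow]
  have ha : 0 < α / ζ := by positivity
  have hm : 0 < 1 / M := by positivity
  have hcp0 : 0 < cp := by rw [hcp]; positivity
  have hc1 : cp * ((α / ζ) ^ 2 + 1 / M) = 1 := by rw [← hcinv]; exact mul_inv_cancel₀ hcp0.ne'
  have h1 : ⟪u, z⟫ ≤ ‖u‖ * ‖p‖ := hz ▸ real_inner_le_norm u z
  have h2 : γ * (α / ζ) ^ 2 * ‖p‖ ^ 2 ≤ α / ζ * (α * ⟪p, Bu z⟫) := by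
    calc _ = α / ζ * (α * (γ / ζ * ‖p‖ ^ 2)) := by field_simp
      _ ≤ _ := by gcongr
  have h3 : -(‖p‖ * ‖Bw w‖) ≤ ⟪p, Bw w⟫ := (abs_le.mp (abs_real_inner_le_norm _ _)).1
  have h4 : -(α / ζ * ‖u‖ * ‖Bw w‖) ≤ α * ⟪Bu u, Bw w⟫ := by
    have h : ‖Bu u‖ ≤ ‖u‖ / ζ := by rw [le_div_iff₀ hζ, mul_comm]; exact hBu u
    have h' : α * (‖Bu u‖ * ‖Bw w‖) ≤ α * (‖u‖ / ζ * ‖Bw w‖) := by gcongr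
    have h'' := mul_le_mul_of_nonneg_left (abs_le.mp (abs_real_inner_le_norm (Bu u) (Bw w))).1 hα.le
    have e : α / ζ * ‖u‖ * ‖Bw w‖ = α * (‖u‖ / ζ * ‖Bw w‖) := by ring
    linarith
  have h1' := mul_le_mul_of_nonneg_left h1 (mul_pos hγ ha).le
  have h2' := mul_le_mul_of_nonneg_left h2 hγ.le
  have h3' := mul_le_mul_of_nonneg_left h3 (show 0 ≤ 1 / M * (τ * cp / 2) by positivity)
  have h4' := mul_le_mul_of_nonneg_left h4 (show 0 ≤ τ * cp / 2 by positivity)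
  rw [hcinv]
  set k := min (1 / 8 : ℝ) (9 * γ ^ 2 / 32)
  have hk1 : k ≤ 1 / 8 := min_le_left _ _
  have hk2 : k ≤ γ ^ 2 / 2 := (min_le_right _ _).trans (by nlinarith [sq_nonneg γ])
  generalize α / ζ = a at *
  generalize 1 / M = m at *
  have hU : k * ‖u‖ ^ 2 ≤ 1 / 4 * ‖u‖ ^ 2 := by gcongr; linarith
  have hP1 : k * (a ^ 2 * ‖p‖ ^ 2) ≤ γ ^ 2 / 2 * (a ^ 2 * ‖p‖ ^ 2) := by gcongr
  have hP2 : k * (m * ‖p‖ ^ 2) ≤ 1 / 2 * (m * ‖p‖ ^ 2) := by gcongr; linarith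
  have hW : k * (τ * ‖w‖ ^ 2) ≤ 1 * (τ * ‖w‖ ^ 2) := by gcongr; linarith
  have hX : k * (τ ^ 2 * cp * ‖Bw w‖ ^ 2) ≤ 1 / 8 * (τ ^ 2 * cp * ‖Bw w‖ ^ 2) := by gcongr
  have e1 : cp * a ^ 2 ≤ 1 := by nlinarith
  have e2 : cp * m ≤ 1 := by nlinarith [mul_nonneg hcp0.le (sq_nonneg a)]
  have f1 : τ ^ 2 * cp * ‖Bw w‖ ^ 2 * (cp * a ^ 2) ≤ τ ^ 2 * cp * ‖Bw w‖ ^ 2 * 1 := by gcongr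
  have f2 : τ ^ 2 * cp * ‖Bw w‖ ^ 2 * (cp * m) ≤ τ ^ 2 * cp * ‖Bw w‖ ^ 2 * 1 := by gcongr
  have g1 := sq_nonneg (‖u‖ - γ * a * ‖p‖)
  have g2 := mul_nonneg hm.le (sq_nonneg (‖p‖ - τ * cp / 2 * ‖Bw w‖))
  have g3 := sq_nonneg (‖u‖ / 2 - τ * cp * a / 2 * ‖Bw w‖)
  linarith

theorem biotNormSq_biotTest_le {Bw : W →ₗ[ℝ] Q} {α τ M ζ cp γ : ℝ}
    (hτ : 0 < τ) (hM : 0 < M) (hcp0 : 0 < cp)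
    (hcp : cp = (α ^ 2 / ζ ^ 2 + 1 / M)⁻¹) (x : V × W × Q) {z : V} (hz : ‖z‖ = ‖x.2.2‖) :
    biotNormSq Bw τ cp (biotTest Bw τ cp (γ * (α / ζ)) x z) ≤
      (3 + 2 * γ ^ 2) * biotNormSq Bw τ cp x := by
  obtain ⟨u, w, p⟩ := x
  simp only [biotNormSq, biotTest] at *
  have hcinv : cp⁻¹ = (α / ζ) ^ 2 + 1 / M := by rw [hcp, inv_inv, div_pow]
  have h1 := norm_sub_sq_le_two_mul u ((γ * (α / ζ)) • z)
  have h2 := mul_le_mul_of_nonneg_left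
    (norm_sub_sq_le_two_mul (-p) ((τ * cp / 2) • Bw w)) (inv_pos.mpr hcp0).le
  rw [norm_smul, mul_pow, Real.norm_eq_abs, sq_abs] at h1 h2
  rw [hz] at h1
  rw [norm_neg] at h2
  have h3 : cp⁻¹ * (2 * ‖p‖ ^ 2 + 2 * ((τ * cp / 2) ^ 2 * ‖Bw w‖ ^ 2)) =
      2 * (cp⁻¹ * ‖p‖ ^ 2) + 1 / 2 * (τ ^ 2 * cp * ‖Bw w‖ ^ 2) := by
    field_simp
  have h4 : γ ^ 2 * ((α / ζ) ^ 2 * ‖p‖ ^ 2) ≤ γ ^ 2 * (cp⁻¹ * ‖p‖ ^ 2) := by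
    gcongr
    rw [hcinv]
    have : 0 < 1 / M := by positivity
    linarith
  have i1 : 0 ≤ cp⁻¹ * ‖p‖ ^ 2 := by positivity
  have i2 : 0 ≤ τ * ‖w‖ ^ 2 := by positivity
  have i3 : 0 ≤ τ ^ 2 * cp * ‖Bw w‖ ^ 2 := by positivity
  have j1 : 0 ≤ γ ^ 2 * ‖u‖ ^ 2 := by positivity
  have j2 := mul_nonneg (sq_nonneg γ) i2
  have j3 := mul_nonneg (sq_nonneg γ) i3
  have j4 := sq_nonneg ‖u‖
  linarith

end BiotAux

/-- Theorem 2.2 (coercivity via a constructed test function): in the abstract discrete Biot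
setting, under (H1) and (H2), there is a constant `γ* > 0` depending only on `γ_B` such that
for every `x = (u,w,p)` there exists `y = (v,r,q)` with `B(x,y) ≥ γ̄ ‖x‖_D²`, where
`γ̄ = min {1/6, 3γ_B²/8}`, and `‖y‖_D ≤ γ* ‖x‖_D`. -/
theorem biotForm_coercive_test_function (γB : ℝ) (hγB : 0 < γB) :
    ∃ γstar : ℝ, 0 < γstar ∧
      ∀ (V W Q : Type)
        (_ : NormedAddCommGroup V) (_ : InnerProductSpace ℝ V) (_ : FiniteDimensional ℝ V)
        (_ : NormedAddCommGroup W) (_ : InnerProductSpace ℝ W) (_ : FiniteDimensional ℝ W)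
        (_ : NormedAddCommGroup Q) (_ : InnerProductSpace ℝ Q) (_ : FiniteDimensional ℝ Q)
        (Bu : V →ₗ[ℝ] Q) (Bw : W →ₗ[ℝ] Q)
        (α τ M μ lam : ℝ), 0 < α → 0 < τ → 0 < M → 0 < μ → 0 < lam →
        ∀ (d : ℕ), 1 ≤ d →
        ∀ (ζ cp : ℝ), ζ = Real.sqrt (lam + 2 * μ / (d : ℝ)) →
          cp = (α ^ 2 / ζ ^ 2 + 1 / M)⁻¹ →
        -- (H1)
        (∀ u : V, ζ * ‖Bu u‖ ≤ ‖u‖) →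
        -- (H2): energy-norm inf-sup with constant γB
        (∀ p : Q, ∃ z : V, ‖z‖ = ‖p‖ ∧ (γB / ζ) * ‖p‖ ^ 2 ≤ ⟪p, Bu z⟫) →
        ∀ x : V × W × Q, ∃ y : V × W × Q,
          min (1 / 6) (3 * γB ^ 2 / 8) * biotNormSq Bw τ cp x ≤ biotForm Bu Bw α τ M x y ∧
          Real.sqrt (biotNormSq Bw τ cp y) ≤ γstar * Real.sqrt (biotNormSq Bw τ cp x) := by
  refine ⟨Real.sqrt ((4 / 3) ^ 2 * (3 + 2 * γB ^ 2)), by positivity, ?_⟩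
  intro V W Q _ _ _ _ _ _ _ _ _ Bu Bw α τ M μ lam hα hτ hM hμ hlam d hd ζ cp hζ hcp hBu hinf x
  have hζ0 : 0 < ζ := by rw [hζ]; positivity
  have hcp0 : 0 < cp := by rw [hcp]; positivity
  obtain ⟨z, hz, hpz⟩ := hinf x.2.2
  refine ⟨(4 / 3 : ℝ) • biotTest Bw τ cp (γB * (α / ζ)) x z, ?_, ?_⟩
  · rw [biotForm_smul_right]
    have h := biotForm_biotTest_ge (Bw := Bw) hα hτ hM hζ0 hγB hcp hBu x hz hpz
    have e : min (1 / 6) (3 * γB ^ 2 / 8) = 4 / 3 * min (1 / 8) (9 * γB ^ 2 / 32) := by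
      rw [mul_min_of_nonneg _ _ (by norm_num)]
      congr 1 <;> ring
    rw [e, mul_assoc]
    gcongr
  · rw [biotNormSq_smul, ← Real.sqrt_mul (by positivity), mul_assoc]
    gcongr
    exact biotNormSq_biotTest_le hτ hM hcp0 hcp x hz
end

section
/- (Theorem 2.2, parameter-robust inf-sup stability of the reduced-quadrature Biot form.) For every γ_B > 0 there exists a constant γ̃ > 0, depending only on γ_B and in particular independent of α, τ, M, μ, λ, d and of the spaces V, W, Q, such that the following holds: in the abstract discrete Biot setting, if hypotheses (H1) and (H2) hold, then for every nonzero x = (u, w, p) ∈ V × W × Q there exists a nonzero y = (v, r, q) ∈ V × W × Q with B(x, y) ≥ γ̃ · ‖x‖_D · ‖y‖_D. -/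
open RealInnerProductSpace

/-- A test triple with a scale-free lower bound for `biotForm` and a scale-free norm bound. -/
theorem exists_biotForm_test {V W Q : Type*}
    [NormedAddCommGroup V] [InnerProductSpace ℝ V]
    [NormedAddCommGroup W] [InnerProductSpace ℝ W]
    [NormedAddCommGroup Q] [InnerProductSpace ℝ Q]
    (Bu : V →ₗ[ℝ] Q) (Bw : W →ₗ[ℝ] Q) {γB α τ M ζ cp : ℝ}
    (hγB : 0 < γB) (hα : 0 < α) (hτ : 0 < τ) (hM : 0 < M) (hζ : 0 < ζ)
    (hcp : cp = (α ^ 2 / ζ ^ 2 + 1 / M)⁻¹)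
    (H1 : ∀ u : V, ζ * ‖Bu u‖ ≤ ‖u‖)
    (H2 : ∀ p : Q, ∃ z : V, ‖z‖ = ‖p‖ ∧ (γB / ζ) * ‖p‖ ^ 2 ≤ ⟪p, Bu z⟫)
    (x : V × W × Q) :
    ∃ y : V × W × Q,
      min (1 / 4) (γB ^ 2 / 4) * biotNormSq Bw τ cp x ≤ biotForm Bu Bw α τ M x y ∧
      biotNormSq Bw τ cp y ≤ (2 + γB ^ 2 / 2) * biotNormSq Bw τ cp x := by
  obtain ⟨u, w, p⟩ := x
  obtain ⟨z, hz, hpz⟩ := H2 p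
  obtain ⟨a, ha⟩ : ∃ a, a = α / ζ := ⟨_, rfl⟩
  obtain ⟨m, hm⟩ : ∃ m, m = 1 / M := ⟨_, rfl⟩
  have ha0 : 0 < a := ha ▸ div_pos hα hζ
  have hm0 : 0 < m := hm ▸ one_div_pos.mpr hM
  have hcp' : cp = (a ^ 2 + m)⁻¹ := by rw [hcp, ha, hm, div_pow]
  have hs : 0 < a ^ 2 + m := by positivity
  have hcp0 : 0 < cp := hcp' ▸ inv_pos.mpr hs
  have hinv : cp⁻¹ = a ^ 2 + m := by rw [hcp', inv_inv]
  have hone : cp * (a ^ 2 + m) = 1 := by rw [← hinv]; exact mul_inv_cancel₀ hcp0.ne'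
  have hcpa : cp * a ^ 2 ≤ 1 := by nlinarith [mul_pos hcp0 hm0]
  have hcpm : cp * m ≤ 1 := by nlinarith [mul_pos hcp0 (pow_pos ha0 2)]
  have hαa : α = a * ζ := by rw [ha]; field_simp
  refine ⟨(u - (γB / 2 * a) • z, w, -p - (1 / 2 * (τ * cp)) • Bw w), ?_, ?_⟩
  · have hform : biotForm Bu Bw α τ M (u, w, p)
        (u - (γB / 2 * a) • z, w, -p - (1 / 2 * (τ * cp)) • Bw w) =
        ‖u‖ ^ 2 + τ * ‖w‖ ^ 2 + m * ‖p‖ ^ 2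
          + γB / 2 * a * (α * ⟪p, Bu z⟫ - ⟪u, z⟫)
          + 1 / 2 * (τ * cp) * (τ * ‖Bw w‖ ^ 2 + m * ⟪p, Bw w⟫ + α * ⟪Bu u, Bw w⟫) := by
      simp only [biotForm, map_sub, map_smul, inner_sub_right, inner_neg_right,
        inner_smul_right, real_inner_self_eq_norm_sq, ← hm]
      rw [real_inner_comm p (Bw w), real_inner_comm p (Bu u)]
      ring
    have hstab : γB * a * ‖p‖ ^ 2 ≤ α * ⟪p, Bu z⟫ := by
      calc γB * a * ‖p‖ ^ 2 = α * (γB / ζ * ‖p‖ ^ 2) := by rw [ha]; ring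
        _ ≤ _ := mul_le_mul_of_nonneg_left hpz hα.le
    have huz : ⟪u, z⟫ ≤ ‖u‖ * ‖p‖ := hz ▸ real_inner_le_norm u z
    have hpc : -(‖p‖ * ‖Bw w‖) ≤ ⟪p, Bw w⟫ :=
      (abs_le.mp (abs_real_inner_le_norm p (Bw w))).1
    have huc : -(a * ‖u‖ * ‖Bw w‖) ≤ α * ⟪Bu u, Bw w⟫ := by
      have h := (abs_le.mp (abs_real_inner_le_norm (Bu u) (Bw w))).1
      have h' := mul_le_mul_of_nonneg_left h hα.le
      have h'' := mul_le_mul_of_nonneg_left (H1 u) (mul_nonneg ha0.le (norm_nonneg (Bw w)))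
      rw [hαa] at h' ⊢
      linarith
    have h2 : γB ^ 2 / 4 * (a ^ 2 * ‖p‖ ^ 2) - 1 / 4 * ‖u‖ ^ 2 ≤
        γB / 2 * a * (α * ⟪p, Bu z⟫ - ⟪u, z⟫) := by
      have h := mul_le_mul_of_nonneg_left (sub_le_sub hstab huz)
        (show 0 ≤ γB / 2 * a by positivity)
      nlinarith [sq_nonneg (γB * a * ‖p‖ - ‖u‖)]
    have h3 : 1 / 4 * (τ ^ 2 * cp * ‖Bw w‖ ^ 2) - 1 / 2 * (m * ‖p‖ ^ 2) - 1 / 2 * ‖u‖ ^ 2 ≤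
        1 / 2 * (τ * cp) * (τ * ‖Bw w‖ ^ 2 + m * ⟪p, Bw w⟫ + α * ⟪Bu u, Bw w⟫) := by
      have e1 := mul_le_mul_of_nonneg_left hpc (show 0 ≤ 1 / 2 * (τ * cp) * m by positivity)
      have e2 := mul_le_mul_of_nonneg_left huc (show 0 ≤ 1 / 2 * (τ * cp) by positivity)
      have e3 := mul_nonneg hcp0.le (sq_nonneg (1 / 2 * (τ * ‖Bw w‖) - m * ‖p‖))
      have e4 := mul_nonneg hcp0.le (sq_nonneg (1 / 2 * (τ * ‖Bw w‖) - a * ‖u‖))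
      have e5 := mul_le_mul_of_nonneg_right hcpm (show 0 ≤ m * ‖p‖ ^ 2 by positivity)
      have e6 := mul_le_mul_of_nonneg_right hcpa (show 0 ≤ ‖u‖ ^ 2 by positivity)
      linarith
    rw [hform]
    simp only [biotNormSq, hinv]
    have k1 := min_le_left (1 / 4 : ℝ) (γB ^ 2 / 4)
    have k2 := min_le_right (1 / 4 : ℝ) (γB ^ 2 / 4)
    have f1 := mul_le_mul_of_nonneg_right k1 (show 0 ≤ ‖u‖ ^ 2 by positivity)
    have f2 := mul_le_mul_of_nonneg_right k1 (show 0 ≤ τ * ‖w‖ ^ 2 by positivity)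
    have f3 := mul_le_mul_of_nonneg_right k1 (show 0 ≤ τ ^ 2 * cp * ‖Bw w‖ ^ 2 by positivity)
    have f4 := mul_le_mul_of_nonneg_right k1 (show 0 ≤ m * ‖p‖ ^ 2 by positivity)
    have f5 := mul_le_mul_of_nonneg_right k2 (show 0 ≤ a ^ 2 * ‖p‖ ^ 2 by positivity)
    have g1 : 0 ≤ τ * ‖w‖ ^ 2 := by positivity
    have g2 : 0 ≤ m * ‖p‖ ^ 2 := by positivity
    linarith
  · have hv : ‖u - (γB / 2 * a) • z‖ ^ 2 ≤ 2 * ‖u‖ ^ 2 + γB ^ 2 / 2 * (a ^ 2 * ‖p‖ ^ 2) := by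
      have h := norm_sub_le u ((γB / 2 * a) • z)
      rw [norm_smul, Real.norm_of_nonneg (show 0 ≤ γB / 2 * a by positivity), hz] at h
      have h' := pow_le_pow_left₀ (norm_nonneg _) h 2
      linarith [sq_nonneg (‖u‖ - γB / 2 * a * ‖p‖)]
    have hq : cp⁻¹ * ‖-p - (1 / 2 * (τ * cp)) • Bw w‖ ^ 2 ≤
        2 * (cp⁻¹ * ‖p‖ ^ 2) + 1 / 2 * (τ ^ 2 * cp * ‖Bw w‖ ^ 2) := by
      have h := norm_sub_le (-p) ((1 / 2 * (τ * cp)) • Bw w)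
      rw [norm_smul, Real.norm_of_nonneg (show 0 ≤ 1 / 2 * (τ * cp) by positivity), norm_neg] at h
      have h' := pow_le_pow_left₀ (norm_nonneg _) h 2
      have h'' : ‖-p - (1 / 2 * (τ * cp)) • Bw w‖ ^ 2 ≤
          2 * ‖p‖ ^ 2 + 1 / 2 * (τ * cp * ‖Bw w‖) ^ 2 := by
        linarith [sq_nonneg (‖p‖ - 1 / 2 * (τ * cp) * ‖Bw w‖)]
      calc _ ≤ cp⁻¹ * (2 * ‖p‖ ^ 2 + 1 / 2 * (τ * cp * ‖Bw w‖) ^ 2) :=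
            mul_le_mul_of_nonneg_left h'' (inv_pos.mpr hcp0).le
        _ = _ := by field_simp
    simp only [biotNormSq]
    have hap : a ^ 2 * ‖p‖ ^ 2 ≤ cp⁻¹ * ‖p‖ ^ 2 := by
      rw [hinv]; gcongr; linarith
    have f1 := mul_le_mul_of_nonneg_left hap (show 0 ≤ γB ^ 2 / 2 by positivity)
    have g1 : 0 ≤ τ * ‖w‖ ^ 2 := by positivity
    have g2 : 0 ≤ τ ^ 2 * cp * ‖Bw w‖ ^ 2 := by positivity
    have g3 : 0 ≤ γB ^ 2 / 2 * ‖u‖ ^ 2 := by positivity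
    have g4 : 0 ≤ γB ^ 2 / 2 * (τ * ‖w‖ ^ 2) := by positivity
    have g5 : 0 ≤ γB ^ 2 / 2 * (τ ^ 2 * cp * ‖Bw w‖ ^ 2) := by positivity
    linarith

theorem biotNormSq_pos {V W Q : Type*}
    [NormedAddCommGroup V] [InnerProductSpace ℝ V]
    [NormedAddCommGroup W] [InnerProductSpace ℝ W]
    [NormedAddCommGroup Q] [InnerProductSpace ℝ Q]
    (Bw : W →ₗ[ℝ] Q) {τ cp : ℝ} (hτ : 0 < τ) (hcp : 0 < cp)
    {x : V × W × Q} (hx : x ≠ 0) : 0 < biotNormSq Bw τ cp x := by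
  obtain ⟨u, w, p⟩ := x
  simp only [biotNormSq]
  by_cases hu : u = 0
  · by_cases hw : w = 0
    · have hp : p ≠ 0 := by
        rintro rfl
        exact hx (by rw [hu, hw]; rfl)
      have := norm_pos_iff.mpr hp
      positivity
    · have := norm_pos_iff.mpr hw
      positivity
  · have := norm_pos_iff.mpr hu
    positivity

/-- Theorem 2.2 (parameter-robust inf-sup stability of the reduced-quadrature Biot form):
for every `γ_B > 0` there is `γ̃ > 0`, depending only on `γ_B` and independent of
`α, τ, M, μ, λ, d` and of the spaces `V, W, Q`, such that under hypotheses (H1) and (H2),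
for every nonzero `x` there exists a nonzero `y` with `B(x, y) ≥ γ̃ ‖x‖_D ‖y‖_D`. -/
theorem biotForm_inf_sup_stable (γB : ℝ) (hγB : 0 < γB) :
    ∃ γt : ℝ, 0 < γt ∧
      ∀ (V W Q : Type)
        (_ : NormedAddCommGroup V) (_ : InnerProductSpace ℝ V) (_ : FiniteDimensional ℝ V)
        (_ : NormedAddCommGroup W) (_ : InnerProductSpace ℝ W) (_ : FiniteDimensional ℝ W)
        (_ : NormedAddCommGroup Q) (_ : InnerProductSpace ℝ Q) (_ : FiniteDimensional ℝ Q)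
        (Bu : V →ₗ[ℝ] Q) (Bw : W →ₗ[ℝ] Q)
        (α τ M μ lam : ℝ), 0 < α → 0 < τ → 0 < M → 0 < μ → 0 < lam →
        ∀ (d : ℕ), 1 ≤ d →
        ∀ (ζ cp : ℝ), ζ = Real.sqrt (lam + 2 * μ / (d : ℝ)) →
          cp = (α ^ 2 / ζ ^ 2 + 1 / M)⁻¹ →
        -- (H1)
        (∀ u : V, ζ * ‖Bu u‖ ≤ ‖u‖) →
        -- (H2): energy-norm inf-sup with constant γB
        (∀ p : Q, ∃ z : V, ‖z‖ = ‖p‖ ∧ (γB / ζ) * ‖p‖ ^ 2 ≤ ⟪p, Bu z⟫) →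
        ∀ x : V × W × Q, x ≠ 0 → ∃ y : V × W × Q, y ≠ 0 ∧
          γt * Real.sqrt (biotNormSq Bw τ cp x) * Real.sqrt (biotNormSq Bw τ cp y) ≤
            biotForm Bu Bw α τ M x y := by
  have hκ : 0 < min (1 / 4) (γB ^ 2 / 4) := lt_min (by norm_num) (by positivity)
  have hK : 0 < 2 + γB ^ 2 / 2 := by positivity
  refine ⟨min (1 / 4) (γB ^ 2 / 4) / √(2 + γB ^ 2 / 2), div_pos hκ (Real.sqrt_pos.mpr hK), ?_⟩
  intro V W Q _ _ _ _ _ _ _ _ _ Bu Bw α τ M μ lam hα hτ hM hμ hlam d _ ζ cp hζ hcp H1 H2 x hx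
  have hζ0 : 0 < ζ := hζ ▸ Real.sqrt_pos.mpr (by positivity)
  have hcp0 : 0 < cp := hcp ▸ (by positivity)
  have hN := biotNormSq_pos Bw hτ hcp0 hx
  obtain ⟨y, hB, hy⟩ := exists_biotForm_test Bu Bw hγB hα hτ hM hζ0 hcp H1 H2 x
  refine ⟨y, ?_, le_trans ?_ hB⟩
  · rintro rfl
    have h0 : biotForm Bu Bw α τ M x 0 = 0 := by simp [biotForm]
    exact absurd (h0 ▸ hB) (not_le.mpr (mul_pos hκ hN))
  · have hsy : √(biotNormSq Bw τ cp y) ≤ √(2 + γB ^ 2 / 2) * √(biotNormSq Bw τ cp x) := by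
      rw [← Real.sqrt_mul hK.le]
      exact Real.sqrt_le_sqrt hy
    have hs := Real.sqrt_pos.mpr hK
    calc _ ≤ min (1 / 4) (γB ^ 2 / 4) / √(2 + γB ^ 2 / 2) * √(biotNormSq Bw τ cp x) *
          (√(2 + γB ^ 2 / 2) * √(biotNormSq Bw τ cp x)) :=
        mul_le_mul_of_nonneg_left hsy (by positivity)
      _ = min (1 / 4) (γB ^ 2 / 4) * (√(biotNormSq Bw τ cp x) * √(biotNormSq Bw τ cp x)) := by
        field_simp
      _ = _ := by rw [Real.mul_self_sqrt hN.le]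
end

section
/- (Theorem 2.2, parameter-robust boundedness of the reduced-quadrature Biot form.) In the abstract discrete Biot setting, assume hypothesis (H1). Then for all x = (u, w, p) and y = (v, r, q) in V × W × Q one has B(x, y) ≤ 8 · ‖x‖_D · ‖y‖_D; in particular the continuity constant is independent of α, τ, M, μ, λ, d and of the spaces V, W, Q. -/
open RealInnerProductSpace

theorem abs_mul_inner_le_of_weighted_bounds {E : Type*}
    [NormedAddCommGroup E] [InnerProductSpace ℝ E] {a b : E} {k s X Y : ℝ}
    (hk : 0 ≤ k) (hY : 0 ≤ Y) (ha : s * ‖a‖ ≤ X) (hb : k * ‖b‖ ≤ s * Y) :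
    |k * ⟪a, b⟫| ≤ X * Y := by
  calc |k * ⟪a, b⟫| = k * |⟪a, b⟫| := by rw [abs_mul, abs_of_nonneg hk]
    _ ≤ k * (‖a‖ * ‖b‖) := by gcongr; exact abs_real_inner_le_norm a b
    _ = ‖a‖ * (k * ‖b‖) := by ring
    _ ≤ ‖a‖ * (s * Y) := by gcongr
    _ = s * ‖a‖ * Y := by ring
    _ ≤ X * Y := by gcongr

/-- Each component of `x` is controlled by the weighted norm; here `s ^ 2 = c_p⁻¹`. -/
theorem component_bounds_biotNormSq {V W Q : Type*}
    [NormedAddCommGroup V] [InnerProductSpace ℝ V]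
    [NormedAddCommGroup W] [InnerProductSpace ℝ W]
    [NormedAddCommGroup Q] [InnerProductSpace ℝ Q]
    (Bw : W →ₗ[ℝ] Q) {τ cp s : ℝ} (hτ : 0 < τ) (hs : 0 < s) (hcp : cp = (s ^ 2)⁻¹)
    (x : V × W × Q) :
    ‖x.1‖ ≤ √(biotNormSq Bw τ cp x) ∧ s * ‖x.2.2‖ ≤ √(biotNormSq Bw τ cp x) ∧
      √τ * ‖x.2.1‖ ≤ √(biotNormSq Bw τ cp x) ∧
      τ * ‖Bw x.2.1‖ ≤ s * √(biotNormSq Bw τ cp x) := by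
  have hN : biotNormSq Bw τ cp x =
      ‖x.1‖ ^ 2 + (s * ‖x.2.2‖) ^ 2 + (√τ * ‖x.2.1‖) ^ 2 + (τ * ‖Bw x.2.1‖ / s) ^ 2 := by
    rw [biotNormSq, hcp, inv_inv, mul_pow √τ, Real.sq_sqrt hτ.le]
    ring
  have h1 := sq_nonneg ‖x.1‖
  have h2 := sq_nonneg (s * ‖x.2.2‖)
  have h3 := sq_nonneg (√τ * ‖x.2.1‖)
  have h4 := sq_nonneg (τ * ‖Bw x.2.1‖ / s)
  refine ⟨Real.le_sqrt_of_sq_le ?_, Real.le_sqrt_of_sq_le ?_, Real.le_sqrt_of_sq_le ?_,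
    (div_le_iff₀' hs).mp (Real.le_sqrt_of_sq_le ?_)⟩ <;> linarith

/-- Parameter-robust boundedness of the reduced-quadrature Biot form (Theorem 2.2):
assuming (H1), `B(x, y) ≤ 8 ‖x‖_D ‖y‖_D` for all `x, y`, with continuity constant `8`
independent of `α, τ, M, μ, λ, d` and of the spaces. -/
theorem biotForm_bounded
    {V W Q : Type*}
    [NormedAddCommGroup V] [InnerProductSpace ℝ V] [FiniteDimensional ℝ V]
    [NormedAddCommGroup W] [InnerProductSpace ℝ W] [FiniteDimensional ℝ W]
    [NormedAddCommGroup Q] [InnerProductSpace ℝ Q] [FiniteDimensional ℝ Q]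
    (Bu : V →ₗ[ℝ] Q) (Bw : W →ₗ[ℝ] Q)
    (α τ M μ lam : ℝ) (hα : 0 < α) (hτ : 0 < τ) (hM : 0 < M) (hμ : 0 < μ) (hlam : 0 < lam)
    (d : ℕ) (hd : 1 ≤ d)
    (ζ cp : ℝ) (hζ : ζ = Real.sqrt (lam + 2 * μ / (d : ℝ)))
    (hcp : cp = (α ^ 2 / ζ ^ 2 + 1 / M)⁻¹)
    (H1 : ∀ u : V, ζ * ‖Bu u‖ ≤ ‖u‖) :
    ∀ x y : V × W × Q,
      biotForm Bu Bw α τ M x y ≤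
        8 * Real.sqrt (biotNormSq Bw τ cp x) * Real.sqrt (biotNormSq Bw τ cp y) := by
  intro x y
  have hζ0 : 0 < ζ := by
    have hd0 : (0 : ℝ) < d := by exact_mod_cast hd
    rw [hζ]
    positivity
  obtain ⟨s, hs, hs2⟩ : ∃ s : ℝ, 0 < s ∧ s ^ 2 = α ^ 2 / ζ ^ 2 + 1 / M :=
    ⟨√(α ^ 2 / ζ ^ 2 + 1 / M), by positivity, Real.sq_sqrt (by positivity)⟩
  rw [← hs2] at hcp
  have hM2 : 1 / M ≤ s ^ 2 := by
    rw [hs2]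
    exact le_add_of_nonneg_left (by positivity)
  have hαs : α / ζ ≤ s := by
    refine (sq_le_sq₀ (by positivity) hs.le).mp ?_
    rw [hs2, div_pow]
    exact le_add_of_nonneg_right (by positivity)
  have hBu (u : V) : α * ‖Bu u‖ ≤ s * ‖u‖ := by
    calc α * ‖Bu u‖ = α / ζ * (ζ * ‖Bu u‖) := by field_simp
      _ ≤ s * ‖u‖ := by gcongr; exact H1 u
  obtain ⟨hxu, hxp, hxw, hxd⟩ := component_bounds_biotNormSq Bw hτ hs hcp x
  obtain ⟨hyu, hyp, hyw, hyd⟩ := component_bounds_biotNormSq Bw hτ hs hcp y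
  unfold biotForm
  have hX := Real.sqrt_nonneg (biotNormSq Bw τ cp x)
  have hY := Real.sqrt_nonneg (biotNormSq Bw τ cp y)
  generalize √(biotNormSq Bw τ cp x) = X at *
  generalize √(biotNormSq Bw τ cp y) = Y at *
  have huv : |1 * ⟪x.1, y.1⟫| ≤ X * Y :=
    abs_mul_inner_le_of_weighted_bounds (s := 1) zero_le_one hY (by simpa using hxu)
      (by simpa using hyu)
  have hpv : |α * ⟪x.2.2, Bu y.1⟫| ≤ X * Y :=
    abs_mul_inner_le_of_weighted_bounds hα.le hY hxp ((hBu y.1).trans (by gcongr))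
  have hwr : |τ * ⟪x.2.1, y.2.1⟫| ≤ X * Y := by
    refine abs_mul_inner_le_of_weighted_bounds hτ.le hY hxw ?_
    calc τ * ‖y.2.1‖ = √τ * (√τ * ‖y.2.1‖) := by rw [← mul_assoc, Real.mul_self_sqrt hτ.le]
      _ ≤ √τ * Y := by gcongr
  have hpr : |τ * ⟪x.2.2, Bw y.2.1⟫| ≤ X * Y :=
    abs_mul_inner_le_of_weighted_bounds hτ.le hY hxp hyd
  have hwq : |τ * ⟪Bw x.2.1, y.2.2⟫| ≤ X * Y := by
    rw [real_inner_comm, mul_comm X]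
    exact abs_mul_inner_le_of_weighted_bounds hτ.le hX hyp hxd
  have hpq : |1 / M * ⟪x.2.2, y.2.2⟫| ≤ X * Y := by
    refine abs_mul_inner_le_of_weighted_bounds (by positivity) hY hxp ?_
    calc 1 / M * ‖y.2.2‖ ≤ s ^ 2 * ‖y.2.2‖ := by gcongr
      _ = s * (s * ‖y.2.2‖) := by ring
      _ ≤ s * Y := by gcongr
  have huq : |α * ⟪Bu x.1, y.2.2⟫| ≤ X * Y := by
    rw [real_inner_comm, mul_comm X]
    exact abs_mul_inner_le_of_weighted_bounds hα.le hX hyp ((hBu x.1).trans (by gcongr))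
  rw [abs_le] at *
  linarith [mul_nonneg hX hY]
end
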